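/- arXiv:0907.0724 — 2 statements merged into one kernel-verified Lean document; each statement's English description precedes it below -/
import Mathlib

section
/- Let S be a set of n points in ℝ³, no three collinear and not all coplanar. Then −3n ≥ Σ_{k≥3} k(k−4)·m_k, where m_k is the number of planes containing exactly k points of S. -/
open Set

noncomputable section

/-- Three-dimensional euclidean space. -/
abbrev Pt3 := EuclideanSpace ℝ (Fin 3)

/-- A plane in space: the affine span of three affinely independent points. -/
def IsPlane (P : Set Pt3) : Prop :=
  ∃ a b c : Pt3, AffineIndependent ℝ ![a, b, c] ∧
    P = (affineSpan ℝ ({a, b, c} : Set Pt3) : Set Pt3)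

/-- `planeCount S k` is the number of planes containing exactly `k` points of `S`. -/
def planeCount (S : Set Pt3) (k : ℕ) : ℕ :=
  {P : Set Pt3 | IsPlane P ∧ (S ∩ P).ncard = k}.ncard

/-- The planes determined by `S`: planes containing at least three points of `S`. -/
def detPlanes (S : Set Pt3) : Set (Set Pt3) :=
  {P : Set Pt3 | IsPlane P ∧ 3 ≤ (S ∩ P).ncard}

/-- No three points of `S` are collinear. -/
def NoThreeCollinear (S : Set Pt3) : Prop :=
  ∀ T ⊆ S, T.ncard = 3 → ¬ Collinear ℝ T

namespace LineArrangement

/-- Of two lines crossing at `x`, the steeper one is above to the right of `x`. -/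
lemma eval_lt_eval_iff {a b c d x y : ℝ} (hac : a < c) (h : a * x + b = c * x + d) :
    a * y + b < c * y + d ↔ x < y := by
  have key : c * y + d - (a * y + b) = (c - a) * (y - x) := by linear_combination -h
  rw [← sub_pos, key, mul_pos_iff_of_pos_left (sub_pos.2 hac), sub_pos]

lemma exists_crossing {a b c d : ℝ} (hac : a ≠ c) : ∃ x, a * x + b = c * x + d :=
  ⟨(d - b) / (a - c), by
    have := sub_ne_zero.2 hac
    field_simp
    ring⟩

lemma exists_crossing_gt {a b c d y : ℝ} (hac : a < c) (h : c * y + d < a * y + b) :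
    ∃ x, y < x ∧ a * x + b = c * x + d := by
  obtain ⟨x, hx⟩ := exists_crossing (b := b) (d := d) hac.ne
  refine ⟨x, lt_of_not_ge fun hle => ?_, hx⟩
  rcases hle.lt_or_eq with hlt | rfl
  · exact lt_asymm h ((eval_lt_eval_iff hac hx).2 hlt)
  · exact h.ne' hx

lemma exists_crossing_lt {a b c d y : ℝ} (hac : a < c) (h : a * y + b < c * y + d) :
    ∃ x, x < y ∧ a * x + b = c * x + d := by
  obtain ⟨x, hx⟩ := exists_crossing (b := b) (d := d) hac.ne
  exact ⟨x, (eval_lt_eval_iff hac hx).1 h, hx⟩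

/-- If the line `i` and the steeper line `j` cross at `x`, a line `m` crossing `i` at `z > x` with
smaller slope crosses `j` between `x` and `z`. -/
lemma exists_crossing_between {ai bi aj bj am bm x z : ℝ} (hij : ai < aj)
    (hx : ai * x + bi = aj * x + bj) (hxz : x < z) (hz : am * z + bm = ai * z + bi)
    (hm : am < ai) : ∃ w, x < w ∧ w < z ∧ am * w + bm = aj * w + bj := by
  obtain ⟨w, hw⟩ := exists_crossing (b := bm) (d := bj) (hm.trans hij).ne
  refine ⟨w, ?_, (eval_lt_eval_iff (hm.trans hij) hw).1 ?_, hw⟩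
  · by_contra! hle
    have h1 : ai * x + bi < am * x + bm := by
      have : (ai - am) * (z - x) = am * x + bm - (ai * x + bi) := by linear_combination -hz
      nlinarith [mul_pos (sub_pos.2 hm) (sub_pos.2 hxz)]
    have h2 : (aj - am) * (x - w) = aj * x + bj - (am * x + bm) := by linear_combination hw
    nlinarith [mul_nonneg (sub_pos.2 (hm.trans hij)).le (sub_nonneg.2 hle)]
  · rw [hz]
    exact (eval_lt_eval_iff hij hx).2 hxz

/-- If the line `i` and the steeper line `j` cross at `x`, a line `m` crossing `i` at `z < x` with
larger slope crosses `j` outside the segment from `z` to `x`. -/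
lemma exists_crossing_outside {ai bi aj bj am bm x z : ℝ} (hij : ai < aj)
    (hx : ai * x + bi = aj * x + bj) (hzx : z < x) (hz : am * z + bm = ai * z + bi)
    (hm : ai < am) (hmj : am ≠ aj) : ∃ w, (w < z ∨ x < w) ∧ am * w + bm = aj * w + bj := by
  have h1 : aj * z + bj < ai * z + bi := by
    have : (aj - ai) * (x - z) = ai * z + bi - (aj * z + bj) := by linear_combination -hx
    nlinarith [mul_pos (sub_pos.2 hij) (sub_pos.2 hzx)]
  have h2 : ai * x + bi < am * x + bm := (eval_lt_eval_iff hm hz.symm).2 hzx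
  rcases hmj.lt_or_gt with h | h
  · obtain ⟨w, hw, e⟩ := exists_crossing_gt (b := bm) (d := bj) (y := x) h (by linarith)
    exact ⟨w, .inr hw, e⟩
  · obtain ⟨w, hw, e⟩ := exists_crossing_lt (b := bj) (d := bm) (y := z) h (by linarith)
    exact ⟨w, .inl hw, e.symm⟩

variable {ι : Type*} (a b : ι → ℝ)

/-- The point `v` lies on the line `y = a i * x + b i`. -/
def Thru (v : ℝ × ℝ) (i : ι) : Prop := a i * v.1 + b i = v.2

/-- The point `v` is a vertex of the arrangement on the line `i`. -/
def VertexOn (i : ι) (v : ℝ × ℝ) : Prop := Thru a b v i ∧ ∃ j ≠ i, Thru a b v j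

/-- The line `i` has the smallest slope among the lines through `v`. -/
def IsBot (v : ℝ × ℝ) (i : ι) : Prop := Thru a b v i ∧ ∀ j, Thru a b v j → a i ≤ a j

/-- The line `i` has the largest slope among the lines through `v`. -/
def IsTop (v : ℝ × ℝ) (i : ι) : Prop := Thru a b v i ∧ ∀ j, Thru a b v j → a j ≤ a i

/-- Among the lines through `v`, the line `j` is the next steeper one after `i`. -/
def IsSucc (v : ℝ × ℝ) (i j : ι) : Prop :=
  Thru a b v i ∧ Thru a b v j ∧ a i < a j ∧ ∀ k, Thru a b v k → a i < a k → a j ≤ a k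

/-- The vertex following `v` on the line `k` is `u`. -/
def IsNext (k : ι) (v u : ℝ × ℝ) : Prop :=
  Thru a b v k ∧ Thru a b u k ∧ v.1 < u.1 ∧ ∀ w, VertexOn a b k w → v.1 < w.1 → u.1 ≤ w.1

/-- The first vertex on the line `k` is `u`. -/
def IsFirst (k : ι) (u : ℝ × ℝ) : Prop :=
  VertexOn a b k u ∧ ∀ w, VertexOn a b k w → u.1 ≤ w.1

/-- The last vertex on the line `k` is `u`. -/
def IsLast (k : ι) (u : ℝ × ℝ) : Prop :=
  VertexOn a b k u ∧ ∀ w, VertexOn a b k w → w.1 ≤ u.1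

/-- The sector to the right of `v` between `i` and its successor is charged to the bottom line
at `u`, with lines closed up at infinity. -/
def ChargeBot (v : ℝ × ℝ) (i : ι) (u : ℝ × ℝ) : Prop :=
  ∃ j, IsSucc a b v i j ∧
    (IsBot a b u i ∧ IsNext a b i v u ∨ IsBot a b u j ∧ IsFirst a b j u ∧ IsLast a b j v)

/-- The sector to the right of `v` between `i` and its successor is charged to the top line
at `u`, with lines closed up at infinity. -/
def ChargeTop (v : ℝ × ℝ) (i : ι) (u : ℝ × ℝ) : Prop :=
  ∃ j, IsSucc a b v i j ∧
    (IsTop a b u j ∧ IsNext a b j v u ∨ IsTop a b u i ∧ IsFirst a b i u ∧ IsLast a b i v)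

variable {a b}

lemma Thru.eval_eq {v : ℝ × ℝ} {i j : ι} (hi : Thru a b v i) (hj : Thru a b v j) :
    a i * v.1 + b i = a j * v.1 + b j :=
  Eq.trans hi (Eq.symm hj)

lemma Thru.point_ext {v w : ℝ × ℝ} {i : ι} (hv : Thru a b v i) (hw : Thru a b w i)
    (h : v.1 = w.1) : v = w :=
  Prod.ext h (by rw [← show _ = v.2 from hv, ← show _ = w.2 from hw, h])

lemma vertexOn_of_crossing {i j : ι} {x : ℝ} (hij : j ≠ i)
    (h : a j * x + b j = a i * x + b i) : VertexOn a b i (x, a i * x + b i) :=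
  ⟨rfl, j, hij, h⟩

lemma Thru.eq_of_ne (ha : Function.Injective a) {v w : ℝ × ℝ} {i j : ι} (hij : i ≠ j)
    (hi : Thru a b v i) (hj : Thru a b v j) (hi' : Thru a b w i) (hj' : Thru a b w j) :
    v = w := by
  refine hi.point_ext hi' ?_
  have h : (a i - a j) * (v.1 - w.1) = 0 := by
    linear_combination hi.eval_eq hj - hi'.eval_eq hj'
  rcases mul_eq_zero.1 h with h | h
  · exact absurd (ha (sub_eq_zero.1 h)) hij
  · exact sub_eq_zero.1 h

lemma IsSucc.vertexOn_left {v : ℝ × ℝ} {i j : ι} (h : IsSucc a b v i j) : VertexOn a b i v :=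
  ⟨h.1, j, by rintro rfl; exact lt_irrefl _ h.2.2.1, h.2.1⟩

lemma IsSucc.vertexOn_right {v : ℝ × ℝ} {i j : ι} (h : IsSucc a b v i j) : VertexOn a b j v :=
  ⟨h.2.1, i, by rintro rfl; exact lt_irrefl _ h.2.2.1, h.1⟩

lemma IsSucc.left_unique (ha : Function.Injective a) {v : ℝ × ℝ} {i i' j : ι}
    (h : IsSucc a b v i j) (h' : IsSucc a b v i' j) : i = i' := by
  refine ha (le_antisymm ?_ ?_) <;> by_contra! hlt
  · exact absurd (h'.2.2.2 i h.1 hlt) (not_le.2 h.2.2.1)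
  · exact absurd (h.2.2.2 i' h'.1 hlt) (not_le.2 h'.2.2.1)

lemma IsBot.unique (ha : Function.Injective a) {v : ℝ × ℝ} {i j : ι} (h : IsBot a b v i)
    (h' : IsBot a b v j) : i = j :=
  ha (le_antisymm (h.2 j h'.1) (h'.2 i h.1))

lemma IsTop.unique (ha : Function.Injective a) {v : ℝ × ℝ} {i j : ι} (h : IsTop a b v i)
    (h' : IsTop a b v j) : i = j :=
  ha (le_antisymm (h'.2 i h.1) (h.2 j h'.1))

lemma IsLast.unique {k : ι} {v w : ℝ × ℝ} (h : IsLast a b k v) (h' : IsLast a b k w) : v = w :=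
  h.1.1.point_ext h'.1.1 (le_antisymm (h'.2 v h.1) (h.2 w h'.1))

lemma IsNext.unique {k : ι} {v w u : ℝ × ℝ} (hv : VertexOn a b k v) (hw : VertexOn a b k w)
    (h : IsNext a b k v u) (h' : IsNext a b k w u) : v = w := by
  refine h.1.point_ext h'.1 (le_antisymm ?_ ?_) <;> by_contra! hlt
  · exact absurd (h'.2.2.2 v hv hlt) (not_le.2 h.2.2.1)
  · exact absurd (h.2.2.2 w hw hlt) (not_le.2 h'.2.2.1)

lemma IsNext.not_isFirst {k : ι} {v u : ℝ × ℝ} (hv : VertexOn a b k v) (h : IsNext a b k v u) :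
    ¬ IsFirst a b k u :=
  fun hf => absurd (hf.2 v hv) (not_le.2 h.2.2.1)

lemma ChargeBot.unique (ha : Function.Injective a) {v v' u : ℝ × ℝ} {i i' : ι}
    (h : ChargeBot a b v i u) (h' : ChargeBot a b v' i' u) : v = v' ∧ i = i' := by
  obtain ⟨j, hs, ⟨hb, hn⟩ | ⟨hb, hf, hl⟩⟩ := h <;>
    obtain ⟨j', hs', ⟨hb', hn'⟩ | ⟨hb', hf', hl'⟩⟩ := h' <;>
    obtain rfl := hb.unique ha hb'
  · exact ⟨hn.unique hs.vertexOn_left hs'.vertexOn_left hn', rfl⟩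
  · exact absurd hf' (hn.not_isFirst hs.vertexOn_left)
  · exact absurd hf (hn'.not_isFirst hs'.vertexOn_left)
  · obtain rfl := hl.unique hl'
    exact ⟨rfl, hs.left_unique ha hs'⟩

lemma ChargeTop.unique (ha : Function.Injective a) {v v' u : ℝ × ℝ} {i i' : ι}
    (h : ChargeTop a b v i u) (h' : ChargeTop a b v' i' u) : v = v' ∧ i = i' := by
  obtain ⟨j, hs, ⟨hb, hn⟩ | ⟨hb, hf, hl⟩⟩ := h <;>
    obtain ⟨j', hs', ⟨hb', hn'⟩ | ⟨hb', hf', hl'⟩⟩ := h' <;>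
    obtain rfl := hb.unique ha hb'
  · obtain rfl := hn.unique hs.vertexOn_right hs'.vertexOn_right hn'
    exact ⟨rfl, hs.left_unique ha hs'⟩
  · exact absurd hf' (hn.not_isFirst hs.vertexOn_right)
  · exact absurd hf (hn'.not_isFirst hs'.vertexOn_right)
  · exact ⟨hl.unique hl', rfl⟩

lemma isBot_of_next {v u : ℝ × ℝ} {i j : ι} (hs : IsSucc a b v i j) (hu : Thru a b u i)
    (hvu : v.1 < u.1) (hj : ∀ w, VertexOn a b j w → v.1 < w.1 → u.1 ≤ w.1) :
    IsBot a b u i := by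
  refine ⟨hu, fun m hm => ?_⟩
  by_contra! hlt
  obtain ⟨w, h1, h2, e⟩ := exists_crossing_between hs.2.2.1 (hs.1.eval_eq hs.2.1) hvu
    (hm.eval_eq hu) hlt
  refine absurd (hj _ (vertexOn_of_crossing ?_ e) h1) (not_le.2 h2)
  rintro rfl
  exact lt_asymm hlt hs.2.2.1

lemma isTop_of_next {v u : ℝ × ℝ} {i j : ι} (hs : IsSucc a b v i j) (hu : Thru a b u j)
    (hvu : v.1 < u.1) (hi : ∀ w, VertexOn a b i w → v.1 < w.1 → u.1 ≤ w.1) :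
    IsTop a b u j := by
  refine ⟨hu, fun m hm => ?_⟩
  by_contra! hlt
  obtain ⟨w, h1, h2, e⟩ := exists_crossing_between (ai := -a j) (bi := -b j) (aj := -a i)
    (bj := -b i) (am := -a m) (bm := -b m) (neg_lt_neg hs.2.2.1)
    (by linear_combination hs.1.eval_eq hs.2.1) hvu
    (by linear_combination hu.eval_eq hm) (neg_lt_neg hlt)
  refine absurd (hi _ (vertexOn_of_crossing (j := m) ?_ (by linear_combination -e)) h1)
    (not_le.2 h2)
  rintro rfl
  exact lt_asymm hlt hs.2.2.1

lemma isTop_of_first (ha : Function.Injective a) {v u : ℝ × ℝ} {i j : ι} (hs : IsSucc a b v i j)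
    (hu : Thru a b u i) (huv : u.1 < v.1) (hl : IsLast a b j v)
    (hj : ∀ w, VertexOn a b j w → u.1 ≤ w.1) : IsTop a b u i := by
  refine ⟨hu, fun m hm => ?_⟩
  by_contra! hlt
  have hmj : m ≠ j := by
    rintro rfl
    exact huv.ne (congrArg Prod.fst (Thru.eq_of_ne ha (ne_of_apply_ne a hlt.ne) hu hm hs.1 hs.2.1))
  obtain ⟨w, h1 | h1, e⟩ := exists_crossing_outside hs.2.2.1 (hs.1.eval_eq hs.2.1) huv
    (hm.eval_eq hu) hlt (ha.ne hmj)
  · exact absurd (hj _ (vertexOn_of_crossing hmj e)) (not_le.2 h1)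
  · exact absurd (hl.2 _ (vertexOn_of_crossing hmj e)) (not_le.2 h1)

lemma isBot_of_first (ha : Function.Injective a) {v u : ℝ × ℝ} {i j : ι} (hs : IsSucc a b v i j)
    (hu : Thru a b u j) (huv : u.1 < v.1) (hl : IsLast a b i v)
    (hi : ∀ w, VertexOn a b i w → u.1 ≤ w.1) : IsBot a b u j := by
  refine ⟨hu, fun m hm => ?_⟩
  by_contra! hlt
  have hmi : m ≠ i := by
    rintro rfl
    exact huv.ne (congrArg Prod.fst (Thru.eq_of_ne ha (ne_of_apply_ne a hlt.ne) hm hu hs.1 hs.2.1))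
  obtain ⟨w, h1, e⟩ := exists_crossing_outside (ai := -a j) (bi := -b j) (aj := -a i)
    (bj := -b i) (am := -a m) (bm := -b m) (neg_lt_neg hs.2.2.1)
    (by linear_combination hs.1.eval_eq hs.2.1) huv
    (by linear_combination hu.eval_eq hm) (neg_lt_neg hlt)
    (fun h => hmi (ha (neg_injective h)))
  have hw := vertexOn_of_crossing hmi (show a m * w + b m = a i * w + b i by
    linear_combination -e)
  rcases h1 with h1 | h1
  · exact absurd (hi _ hw) (not_le.2 h1)
  · exact absurd (hl.2 _ hw) (not_le.2 h1)

lemma not_chargeTop_of_isFirst (ha : Function.Injective a) {g : ι} (hg : ∀ i, a i ≤ a g)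
    {u v : ℝ × ℝ} {i : ι} (hu : IsFirst a b g u) : ¬ ChargeTop a b v i u := by
  have ht : IsTop a b u g := ⟨hu.1.1, fun j _ => hg j⟩
  rintro ⟨j, hs, ⟨hb, hn⟩ | ⟨hb, -, -⟩⟩
  · obtain rfl := ht.unique ha hb
    exact hn.not_isFirst hs.vertexOn_right hu
  · obtain rfl := ht.unique ha hb
    exact absurd (hg j) (not_le.2 hs.2.2.1)

lemma not_chargeBot_of_isFirst (ha : Function.Injective a) {g : ι} (hg : ∀ i, a g ≤ a i)
    {u v : ℝ × ℝ} {i : ι} (hu : IsFirst a b g u) : ¬ ChargeBot a b v i u := by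
  have ht : IsBot a b u g := ⟨hu.1.1, fun j _ => hg j⟩
  rintro ⟨j, hs, ⟨hb, hn⟩ | ⟨hb, -, -⟩⟩
  · obtain rfl := ht.unique ha hb
    exact hn.not_isFirst hs.vertexOn_left hu
  · obtain rfl := ht.unique ha hb
    exact absurd (hg i) (not_le.2 hs.2.2.1)

lemma IsLast.le_eval_of_min (ha : Function.Injective a) {s : ι} (hs : ∀ i, a s ≤ a i)
    {u : ℝ × ℝ} (hu : IsLast a b s u) (i : ι) : u.2 ≤ a i * u.1 + b i := by
  by_contra! hlt
  have hne : s ≠ i := by rintro rfl; exact hlt.ne hu.1.1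
  obtain ⟨x, hx, e⟩ := exists_crossing_gt (b := b s) (d := b i)
    (lt_of_le_of_ne (hs i) (ha.ne hne)) (hlt.trans_eq (Eq.symm hu.1.1))
  exact absurd (hu.2 _ (vertexOn_of_crossing hne.symm e.symm)) (not_le.2 hx)

lemma IsLast.eval_le_of_max (ha : Function.Injective a) {g : ι} (hg : ∀ i, a i ≤ a g)
    {u : ℝ × ℝ} (hu : IsLast a b g u) (i : ι) : a i * u.1 + b i ≤ u.2 := by
  by_contra! hlt
  have hne : i ≠ g := by rintro rfl; exact hlt.ne' hu.1.1
  obtain ⟨x, hx, e⟩ := exists_crossing_gt (b := b i) (d := b g)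
    (lt_of_le_of_ne (hg i) (ha.ne hne)) (lt_of_eq_of_lt hu.1.1 hlt)
  exact absurd (hu.2 _ (vertexOn_of_crossing hne e)) (not_le.2 hx)

lemma IsFirst.lt_of_isLast {k j : ι} {u v : ℝ × ℝ} (hf : IsFirst a b k u) (hl : IsLast a b k v)
    (hv : Thru a b v j) (hu : ¬ Thru a b u j) : u.1 < v.1 := by
  refine lt_of_le_of_ne (hf.2 v hl.1) fun h => hu ?_
  rwa [hf.1.1.point_ext hl.1.1 h]

lemma not_chargeTop_of_isLast (ha : Function.Injective a) {s : ι} (hmin : ∀ i, a s ≤ a i)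
    {u v : ℝ × ℝ} {i : ι} (hu : IsLast a b s u) : ¬ ChargeTop a b v i u := by
  rintro ⟨j, hs, ⟨hb, hn⟩ | ⟨hb, hf, hl⟩⟩
  · have h := (eval_lt_eval_iff hs.2.2.1 (hs.1.eval_eq hs.2.1)).2 hn.2.2.1
    rw [show _ = u.2 from hb.1] at h
    exact absurd (hu.le_eval_of_min ha hmin i) (not_le.2 h)
  · have hlt := hf.lt_of_isLast hl hs.2.1 fun h => absurd (hb.2 j h) (not_le.2 hs.2.2.1)
    have h := mul_pos (sub_pos.2 hs.2.2.1) (sub_pos.2 hlt)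
    have h1 : _ = u.2 := hb.1
    nlinarith [hu.le_eval_of_min ha hmin j, hs.1.eval_eq hs.2.1]

lemma not_chargeBot_of_isLast (ha : Function.Injective a) {g : ι} (hmax : ∀ i, a i ≤ a g)
    {u v : ℝ × ℝ} {i : ι} (hu : IsLast a b g u) : ¬ ChargeBot a b v i u := by
  rintro ⟨j, hs, ⟨hb, hn⟩ | ⟨hb, hf, hl⟩⟩
  · have h := (eval_lt_eval_iff hs.2.2.1 (hs.1.eval_eq hs.2.1)).2 hn.2.2.1
    rw [show _ = u.2 from hb.1] at h
    exact absurd (hu.eval_le_of_max ha hmax j) (not_le.2 h)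
  · have hlt := hf.lt_of_isLast hl hs.1 fun h => absurd (hb.2 i h) (not_le.2 hs.2.2.1)
    have h := mul_pos (sub_pos.2 hs.2.2.1) (sub_pos.2 hlt)
    have h1 : _ = u.2 := hb.1
    nlinarith [hu.eval_le_of_max ha hmax i, hs.1.eval_eq hs.2.1]

lemma not_isFirst_of_isLast (ha : Function.Injective a)
    (hne : ¬ ∃ v, ∀ i, Thru a b v i) {k : ι} {u : ℝ × ℝ} (hl : IsLast a b k u) :
    ¬ IsFirst a b k u := by
  refine fun hf => hne ⟨u, fun i => ?_⟩
  by_cases hik : i = k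
  · exact hik ▸ hl.1.1
  obtain ⟨x, e⟩ := exists_crossing (b := b i) (d := b k) (ha.ne hik)
  have hw := vertexOn_of_crossing hik e
  rw [hl.1.1.point_ext hw.1 (le_antisymm (hf.2 _ hw) (hl.2 _ hw))]
  exact e

lemma finite_setOf_vertices [Finite ι] (ha : Function.Injective a) :
    {v | ∃ i j, i ≠ j ∧ Thru a b v i ∧ Thru a b v j}.Finite := by
  simp only [Set.ofPred_exists]
  refine Set.finite_iUnion fun i => Set.finite_iUnion fun j => Set.Subsingleton.finite ?_
  rintro v ⟨hij, hi, hj⟩ w ⟨-, hi', hj'⟩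
  exact Thru.eq_of_ne ha hij hi hj hi' hj'

section Counting

variable {V : Finset (ℝ × ℝ)}
  (hV : ∀ v, v ∈ V ↔ ∃ i j, i ≠ j ∧ Thru a b v i ∧ Thru a b v j)
include hV

lemma VertexOn.mem {k : ι} {v : ℝ × ℝ} (h : VertexOn a b k v) : v ∈ V :=
  let ⟨h1, j, hj, h2⟩ := h
  (hV v).2 ⟨j, k, hj, h2, h1⟩

lemma exists_charge (ha : Function.Injective a) (hne : ¬ ∃ v, ∀ i, Thru a b v i) {v : ℝ × ℝ}
    {i j : ι} (hs : IsSucc a b v i j) :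
    ∃ u ∈ V, ChargeBot a b v i u ∨ ChargeTop a b v i u := by
  classical
  let N := {u ∈ V | VertexOn a b i u ∨ VertexOn a b j u}
  have hN : ∀ w, w ∈ N ↔ VertexOn a b i w ∨ VertexOn a b j w := fun w => by
    simp only [N, Finset.mem_filter, and_iff_right_iff_imp]
    exact fun h => h.elim (·.mem hV) (·.mem hV)
  by_cases hR : ∃ u ∈ N, v.1 < u.1
  · obtain ⟨u, hu, hmin⟩ := Finset.exists_min_image {u ∈ N | v.1 < u.1} Prod.fst
      (by simpa only [Finset.Nonempty, Finset.mem_filter] using hR)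
    obtain ⟨huN, hvu⟩ := Finset.mem_filter.1 hu
    have hi : ∀ w, VertexOn a b i w → v.1 < w.1 → u.1 ≤ w.1 := fun w hw h =>
      hmin w (Finset.mem_filter.2 ⟨(hN w).2 (.inl hw), h⟩)
    have hj : ∀ w, VertexOn a b j w → v.1 < w.1 → u.1 ≤ w.1 := fun w hw h =>
      hmin w (Finset.mem_filter.2 ⟨(hN w).2 (.inr hw), h⟩)
    refine ⟨u, (Finset.mem_filter.1 huN).1, ?_⟩
    rcases (hN u).1 huN with h | h
    · exact .inl ⟨j, hs, .inl ⟨isBot_of_next hs h.1 hvu hj, hs.1, h.1, hvu, hi⟩⟩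
    · exact .inr ⟨j, hs, .inl ⟨isTop_of_next hs h.1 hvu hi, hs.2.1, h.1, hvu, hj⟩⟩
  · push Not at hR
    have hli : IsLast a b i v := ⟨hs.vertexOn_left, fun w hw => hR w ((hN w).2 (.inl hw))⟩
    have hlj : IsLast a b j v := ⟨hs.vertexOn_right, fun w hw => hR w ((hN w).2 (.inr hw))⟩
    obtain ⟨u, hu, hmin⟩ := Finset.exists_min_image N Prod.fst ⟨v, (hN v).2 (.inl hli.1)⟩
    have hi : ∀ w, VertexOn a b i w → u.1 ≤ w.1 := fun w hw => hmin w ((hN w).2 (.inl hw))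
    have hj : ∀ w, VertexOn a b j w → u.1 ≤ w.1 := fun w hw => hmin w ((hN w).2 (.inr hw))
    refine ⟨u, (Finset.mem_filter.1 hu).1, ?_⟩
    rcases (hN u).1 hu with h | h
    · have huv : u.1 < v.1 := lt_of_le_of_ne (hR u hu) fun e =>
        not_isFirst_of_isLast ha hne hli (h.1.point_ext hli.1.1 e ▸ ⟨h, hi⟩)
      exact .inr ⟨j, hs, .inr ⟨isTop_of_first ha hs h.1 huv hlj hj, ⟨h, hi⟩, hli⟩⟩
    · have huv : u.1 < v.1 := lt_of_le_of_ne (hR u hu) fun e =>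
        not_isFirst_of_isLast ha hne hlj (h.1.point_ext hlj.1.1 e ▸ ⟨h, hj⟩)
      exact .inl ⟨j, hs, .inr ⟨isBot_of_first ha hs h.1 huv hli hi, ⟨h, hj⟩, hlj⟩⟩

lemma exists_isFirst {k : ι} (hk : ∃ v, VertexOn a b k v) : ∃ u, IsFirst a b k u := by
  classical
  obtain ⟨v, hv⟩ := hk
  obtain ⟨u, hu, h⟩ := Finset.exists_min_image {w ∈ V | VertexOn a b k w} Prod.fst
    ⟨v, Finset.mem_filter.2 ⟨hv.mem hV, hv⟩⟩
  exact ⟨u, (Finset.mem_filter.1 hu).2, fun w hw => h w (Finset.mem_filter.2 ⟨hw.mem hV, hw⟩)⟩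

lemma exists_isLast {k : ι} (hk : ∃ v, VertexOn a b k v) : ∃ u, IsLast a b k u := by
  classical
  obtain ⟨v, hv⟩ := hk
  obtain ⟨u, hu, h⟩ := Finset.exists_max_image {w ∈ V | VertexOn a b k w} Prod.fst
    ⟨v, Finset.mem_filter.2 ⟨hv.mem hV, hv⟩⟩
  exact ⟨u, (Finset.mem_filter.1 hu).2, fun w hw => h w (Finset.mem_filter.2 ⟨hw.mem hV, hw⟩)⟩

/-- At least three of the top and bottom lines at vertices receive no charge: those bordering the
face that contains the vertical point at infinity. -/
lemma exists_three_uncharged [Finite ι] (ha : Function.Injective a)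
    (hne : ¬ ∃ v, ∀ i, Thru a b v i) :
    ∃ U ⊆ V ×ˢ (Finset.univ : Finset Bool), U.card = 3 ∧ ∀ u β, (u, β) ∈ U → ∀ v i,
      ¬ cond β (ChargeTop a b v i u) (ChargeBot a b v i u) := by
  classical
  have hι : Nonempty ι := by
    by_contra h
    exact hne ⟨0, fun i => absurd ⟨i⟩ h⟩
  obtain ⟨g, hg⟩ := Finite.exists_max a
  obtain ⟨s, hs⟩ := Finite.exists_min a
  have hgs : g ≠ s := by
    rintro rfl
    exact hne ⟨(0, b g), fun i => by
      rw [ha (le_antisymm (hg i) (hs i))]; simp [Thru]⟩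
  obtain ⟨x, e⟩ := exists_crossing (b := b g) (d := b s) (ha.ne hgs)
  have hvs : ∃ v, VertexOn a b s v := ⟨_, vertexOn_of_crossing hgs e⟩
  have hvg : ∃ v, VertexOn a b g v := ⟨_, vertexOn_of_crossing hgs.symm e.symm⟩
  obtain ⟨fg, hfg⟩ := exists_isFirst hV hvg
  obtain ⟨fs, hfs⟩ := exists_isFirst hV hvs
  obtain ⟨lg, hlg⟩ := exists_isLast hV hvg
  obtain ⟨ls, hls⟩ := exists_isLast hV hvs
  have hmem : ∀ {k u} β, VertexOn a b k u → (u, β) ∈ V ×ˢ (Finset.univ : Finset Bool) :=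
    fun β h => Finset.mem_product.2 ⟨h.mem hV, Finset.mem_univ β⟩
  have h1 : ∀ v i, ¬ ChargeTop a b v i fg := fun v i => not_chargeTop_of_isFirst ha hg hfg
  have h2 : ∀ v i, ¬ ChargeBot a b v i fs := fun v i => not_chargeBot_of_isFirst ha hs hfs
  have h3 : ∀ v i, ¬ ChargeTop a b v i ls := fun v i => not_chargeTop_of_isLast ha hs hls
  have h4 : ∀ v i, ¬ ChargeBot a b v i lg := fun v i => not_chargeBot_of_isLast ha hg hlg
  by_cases h : fg = ls
  · have h' : fs ≠ lg := by
      rintro rfl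
      subst h
      have hle : fs.1 = fg.1 := le_antisymm (hfs.2 _ hls.1) (hfg.2 _ hlg.1)
      obtain rfl := hfs.1.1.point_ext hls.1.1 hle
      exact not_isFirst_of_isLast ha hne hls hfs
    refine ⟨{(fg, true), (fs, false), (lg, false)}, ?_, ?_, ?_⟩
    · simp only [Finset.insert_subset_iff, Finset.singleton_subset_iff]
      exact ⟨hmem _ hfg.1, hmem _ hfs.1, hmem _ hlg.1⟩
    · exact Finset.card_eq_three.2 ⟨_, _, _, by simp, by simp, by simpa using h', rfl⟩
    · simp only [Finset.mem_insert, Finset.mem_singleton, Prod.mk.injEq]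
      rintro u β (⟨rfl, rfl⟩ | ⟨rfl, rfl⟩ | ⟨rfl, rfl⟩)
      exacts [h1, h2, h4]
  · refine ⟨{(fs, false), (fg, true), (ls, true)}, ?_, ?_, ?_⟩
    · simp only [Finset.insert_subset_iff, Finset.singleton_subset_iff]
      exact ⟨hmem _ hfs.1, hmem _ hfg.1, hmem _ hls.1⟩
    · exact Finset.card_eq_three.2 ⟨_, _, _, by simp, by simp, by simpa using h, rfl⟩
    · simp only [Finset.mem_insert, Finset.mem_singleton, Prod.mk.injEq]
      rintro u β (⟨rfl, rfl⟩ | ⟨rfl, rfl⟩ | ⟨rfl, rfl⟩)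
      exacts [h2, h1, h3]

open Classical in
lemma card_sectors [Fintype ι] (ha : Function.Injective a) {v : ℝ × ℝ} (hv : v ∈ V) :
    ({i | ∃ j, IsSucc a b v i j} : Finset ι).card + 1 =
      ({i | Thru a b v i} : Finset ι).card := by
  obtain ⟨i₀, -, -, hi₀, -⟩ := (hV v).1 hv
  obtain ⟨g, hg, hmax⟩ := Finset.exists_max_image ({i | Thru a b v i} : Finset ι) a
    ⟨i₀, by simpa using hi₀⟩
  rw [← Finset.card_erase_add_one hg]
  congr 2
  ext i
  simp only [Finset.mem_filter, Finset.mem_univ, true_and, Finset.mem_erase] at hg hmax ⊢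
  constructor
  · rintro ⟨j, hs⟩
    refine ⟨?_, hs.1⟩
    rintro rfl
    exact absurd (hmax j hs.2.1) (not_le.2 hs.2.2.1)
  · rintro ⟨hig, hi⟩
    obtain ⟨j, hj, hmin⟩ := Finset.exists_min_image
      ({j | Thru a b v j ∧ a i < a j} : Finset ι) a
      ⟨g, by simpa using ⟨hg, lt_of_le_of_ne (hmax i hi) (ha.ne hig)⟩⟩
    simp only [Finset.mem_filter, Finset.mem_univ, true_and] at hj hmin
    exact ⟨j, hi, hj.1, hj.2, fun k hk h => hmin k ⟨hk, h⟩⟩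

open Classical in
/-- **Melchior's inequality** for an arrangement of lines with distinct slopes that are not all
concurrent. -/
theorem melchior [Fintype ι] (ha : Function.Injective a) (hne : ¬ ∃ v, ∀ i, Thru a b v i) :
    ∑ v ∈ V, ((({i | Thru a b v i} : Finset ι).card : ℤ) - 3) ≤ -3 := by
  obtain ⟨U, hUV, hU3, hU⟩ := exists_three_uncharged hV ha hne
  let sectors : Finset (Σ _ : ℝ × ℝ, ι) := V.sigma fun v => {i | ∃ j, IsSucc a b v i j}
  have hle : sectors.card ≤ (V ×ˢ (Finset.univ : Finset Bool) \ U).card := by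
    refine Finset.card_le_card_of_forall_subsingleton
      (fun c t => cond t.2 (ChargeTop a b c.1 c.2 t.1) (ChargeBot a b c.1 c.2 t.1)) ?_ ?_
    · rintro ⟨v, i⟩ hvi
      simp only [sectors, Finset.mem_sigma, Finset.mem_filter, Finset.mem_univ, true_and] at hvi
      obtain ⟨-, j, hs⟩ := hvi
      obtain ⟨u, huV, h | h⟩ := exists_charge hV ha hne hs
      · exact ⟨(u, false), Finset.mem_sdiff.2 ⟨by simpa using huV, fun hm => hU _ _ hm v i h⟩, h⟩
      · exact ⟨(u, true), Finset.mem_sdiff.2 ⟨by simpa using huV, fun hm => hU _ _ hm v i h⟩, h⟩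
    · rintro ⟨u, β⟩ - ⟨v, i⟩ ⟨-, h⟩ ⟨v', i'⟩ ⟨-, h'⟩
      cases β
      · obtain ⟨rfl, rfl⟩ := ChargeBot.unique ha h h'
        rfl
      · obtain ⟨rfl, rfl⟩ := ChargeTop.unique ha h h'
        rfl
  rw [Finset.card_sdiff_of_subset hUV, hU3, Finset.card_product, Finset.card_univ,
    Fintype.card_bool, Finset.card_sigma] at hle
  have h3 : 3 ≤ V.card * 2 := by
    simpa [hU3] using Finset.card_le_card hUV
  have hsum : ∑ v ∈ V, ((({i | Thru a b v i} : Finset ι).card : ℤ) - 3) =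
      ∑ v ∈ V, ((({i | ∃ j, IsSucc a b v i j} : Finset ι).card : ℤ) - 2) :=
    Finset.sum_congr rfl fun v hv => by
      rw [← card_sectors hV ha hv]
      push_cast
      ring
  rw [hsum, Finset.sum_sub_distrib, Finset.sum_const, nsmul_eq_mul]
  have hle' : ((∑ v ∈ V, ({i | ∃ j, IsSucc a b v i j} : Finset ι).card : ℕ) : ℤ) + 3 ≤
      V.card * 2 := by
    omega
  push_cast at hle'
  linarith

end Counting

end LineArrangement

section Projection

/-- The linear functional with coordinates `(1, t, t ^ 2)`. -/
def momentForm (t : ℝ) (d : Pt3) : ℝ := d 0 + t * d 1 + t ^ 2 * d 2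

/-- The derivative of `momentForm` in the parameter. -/
def momentDeriv (t : ℝ) (d : Pt3) : ℝ := d 1 + 2 * t * d 2

lemma finite_setOf_quadratic_eq_zero {A B C : ℝ} (h : ¬ (A = 0 ∧ B = 0 ∧ C = 0)) :
    {t : ℝ | A + B * t + C * t ^ 2 = 0}.Finite := by
  let P : Polynomial ℝ := Polynomial.C C * Polynomial.X ^ 2 + Polynomial.C B * Polynomial.X +
    Polynomial.C A
  have hP : P ≠ 0 := fun hP => h
    ⟨by simpa [P, Polynomial.coeff_X, Polynomial.coeff_C] using congrArg (·.coeff 0) hP,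
      by simpa [P, Polynomial.coeff_X, Polynomial.coeff_C] using congrArg (·.coeff 1) hP,
      by simpa [P, Polynomial.coeff_X, Polynomial.coeff_C] using congrArg (·.coeff 2) hP⟩
  refine (Polynomial.finite_setOfPred_isRoot hP).subset fun t ht => ?_
  have ht : A + B * t + C * t ^ 2 = 0 := ht
  simp only [P, Set.mem_ofPred_eq, Polynomial.IsRoot.def, Polynomial.eval_add, Polynomial.eval_mul,
    Polynomial.eval_C, Polynomial.eval_pow, Polynomial.eval_X]
  linear_combination ht

lemma finite_setOf_momentForm_eq_zero {d : Pt3} (hd : d ≠ 0) :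
    {t | momentForm t d = 0}.Finite := by
  refine (finite_setOf_quadratic_eq_zero (A := d 0) (B := d 1) (C := d 2) ?_).subset fun t ht => ?_
  · rintro ⟨h0, h1, h2⟩
    refine hd (PiLp.ext fun i => ?_)
    fin_cases i <;> assumption
  · have ht : d 0 + t * d 1 + t ^ 2 * d 2 = 0 := ht
    show _ = _
    linear_combination ht

lemma exists_smul_eq_of_minors_eq_zero {d e : Pt3} (hd : d ≠ 0) (h10 : d 1 * e 0 = e 1 * d 0)
    (h20 : d 2 * e 0 = e 2 * d 0) (h21 : d 2 * e 1 = e 2 * d 1) : ∃ s : ℝ, e = s • d := by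
  obtain ⟨i, hi⟩ : ∃ i, d i ≠ 0 := by
    by_contra! h
    exact hd (PiLp.ext h)
  refine ⟨e i / d i, PiLp.ext fun j => ?_⟩
  rw [PiLp.smul_apply, smul_eq_mul, div_mul_eq_mul_div, eq_div_iff hi]
  fin_cases i <;> fin_cases j <;> simp only [Fin.zero_eta, Fin.mk_one, Fin.reduceFinMk] <;>
    linarith

lemma finite_setOf_wronskian_eq_zero {d e : Pt3} (hd : d ≠ 0) (h : ¬ ∃ s : ℝ, e = s • d) :
    {t | momentDeriv t d * momentForm t e = momentDeriv t e * momentForm t d}.Finite := by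
  refine (finite_setOf_quadratic_eq_zero (A := d 1 * e 0 - e 1 * d 0)
    (B := 2 * (d 2 * e 0 - e 2 * d 0)) (C := d 2 * e 1 - e 2 * d 1) ?_).subset fun t ht => ?_
  · rintro ⟨h0, h1, h2⟩
    exact h (exists_smul_eq_of_minors_eq_zero hd (by linarith) (by linarith) (by linarith))
  · have ht : (d 1 + 2 * t * d 2) * (e 0 + t * e 1 + t ^ 2 * e 2) =
      (e 1 + 2 * t * e 2) * (d 0 + t * d 1 + t ^ 2 * d 2) := ht
    show _ = _
    linear_combination ht

lemma NoThreeCollinear.not_collinear {S : Set Pt3} (h3 : NoThreeCollinear S) {p q r : Pt3}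
    (hp : p ∈ S) (hq : q ∈ S) (hr : r ∈ S) (hpq : p ≠ q) (hpr : p ≠ r) (hqr : q ≠ r) :
    ¬ Collinear ℝ {p, q, r} :=
  h3 _ (by simp [Set.insert_subset_iff, hp, hq, hr])
    (Set.ncard_eq_three.2 ⟨p, q, r, hpq, hpr, hqr, rfl⟩)

lemma NoThreeCollinear.exists_generic {S : Set Pt3} (hS : S.Finite) (h3 : NoThreeCollinear S)
    {p : Pt3} (hp : p ∈ S) :
    ∃ t, (∀ q ∈ S, q ≠ p → momentForm t (q - p) ≠ 0) ∧
      ∀ q ∈ S, ∀ r ∈ S, q ≠ p → r ≠ p → q ≠ r →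
        momentDeriv t (q - p) * momentForm t (r - p) ≠
          momentDeriv t (r - p) * momentForm t (q - p) := by
  have hS' : (S \ {p}).Finite := hS.subset Set.sdiff_subset
  have hfin1 : (⋃ q ∈ S \ {p}, {t | momentForm t (q - p) = 0}).Finite :=
    hS'.biUnion fun q hq => finite_setOf_momentForm_eq_zero (sub_ne_zero.2 hq.2)
  have hfin2 : (⋃ x ∈ (S \ {p}).offDiag, {t | momentDeriv t (x.1 - p) * momentForm t (x.2 - p) =
      momentDeriv t (x.2 - p) * momentForm t (x.1 - p)}).Finite := by
    refine hS'.offDiag.biUnion fun ⟨q, r⟩ ⟨hq, hr, hqr⟩ =>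
      finite_setOf_wronskian_eq_zero (sub_ne_zero.2 hq.2) ?_
    rintro ⟨s, hs⟩
    refine h3.not_collinear hp hq.1 hr.1 (Ne.symm hq.2) (Ne.symm hr.2) hqr
      ((collinear_iff_of_mem (p₀ := p) (by simp)).2 ⟨q - p, ?_⟩)
    rintro z (rfl | rfl | rfl)
    · exact ⟨0, by simp⟩
    · exact ⟨1, by simp⟩
    · exact ⟨s, by rw [← hs]; simp⟩
  obtain ⟨t, ht⟩ := (hfin1.union hfin2).exists_notMem
  simp only [Set.mem_union, Set.mem_iUnion, Set.mem_sdiff, Set.mem_singleton_iff, Set.mem_offDiag,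
    Set.mem_ofPred_eq, exists_prop, not_or, not_exists, not_and, Prod.forall] at ht
  exact ⟨t, fun q hq hqp => ht.1 q ⟨hq, hqp⟩,
    fun q hq r hr hqp hrp hqr => ht.2 q r ⟨⟨hq, hqp⟩, ⟨hr, hrp⟩, hqr⟩⟩

/-- The linear functional whose kernel is dual to the point `v`. -/
def dualForm (t : ℝ) (v : ℝ × ℝ) : Pt3 →ₗ[ℝ] ℝ where
  toFun d := momentDeriv t d * v.1 + d 2 - v.2 * momentForm t d
  map_add' d e := by simp only [momentDeriv, momentForm, PiLp.add_apply]; ring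
  map_smul' s d := by
    simp only [momentDeriv, momentForm, PiLp.smul_apply, smul_eq_mul, RingHom.id_apply]; ring

lemma dualForm_apply (t : ℝ) (v : ℝ × ℝ) (d : Pt3) :
    dualForm t v d = momentDeriv t d * v.1 + d 2 - v.2 * momentForm t d := rfl

lemma dualForm_ne_zero (t : ℝ) (v : ℝ × ℝ) : dualForm t v ≠ 0 := by
  intro h
  have h1 := DFunLike.congr_fun h !₂[t ^ 2, -2 * t, 1]
  simp [dualForm_apply, momentDeriv, momentForm] at h1
  apply one_ne_zero (α := ℝ)
  linear_combination h1

lemma finrank_ker_dualForm (t : ℝ) (v : ℝ × ℝ) :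
    Module.finrank ℝ (LinearMap.ker (dualForm t v)) = 2 := by
  have := Module.Dual.finrank_ker_add_one_of_ne_zero (dualForm_ne_zero t v)
  simpa using this

/-- The plane through `p` dual to the point `v`. -/
def dualPlane (t : ℝ) (p : Pt3) (v : ℝ × ℝ) : AffineSubspace ℝ Pt3 :=
  AffineSubspace.mk' p (LinearMap.ker (dualForm t v))

lemma mem_dualPlane {t : ℝ} {p : Pt3} {v : ℝ × ℝ} {z : Pt3} :
    z ∈ dualPlane t p v ↔ dualForm t v (z - p) = 0 := by
  simp [dualPlane, AffineSubspace.mem_mk']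

lemma finrank_vectorSpan_triple {p q r : Pt3} (h : ¬ Collinear ℝ {p, q, r}) :
    Module.finrank ℝ (vectorSpan ℝ ({p, q, r} : Set Pt3)) = 2 := by
  have hi := (affineIndependent_iff_not_collinear_set.2 h).finrank_vectorSpan (n := 2) (by simp)
  rwa [show Set.range ![p, q, r] = {p, q, r} by
    simp only [Matrix.range_cons, Matrix.range_empty, Set.singleton_union, Set.union_empty]] at hi

lemma affineSpan_eq_of_mem {A : AffineSubspace ℝ Pt3} (hA : Module.finrank ℝ A.direction = 2)
    {p q r : Pt3} (hp : p ∈ A) (hq : q ∈ A) (hr : r ∈ A) (h : ¬ Collinear ℝ {p, q, r}) :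
    affineSpan ℝ {p, q, r} = A := by
  have hle : affineSpan ℝ {p, q, r} ≤ A :=
    affineSpan_le.2 (by simp [Set.insert_subset_iff, hp, hq, hr])
  refine AffineSubspace.eq_of_direction_eq_of_nonempty_of_le
    (Submodule.eq_of_le_of_finrank_eq (AffineSubspace.direction_le hle) ?_)
    ⟨p, subset_affineSpan ℝ _ (by simp)⟩ hle
  rw [hA, direction_affineSpan, finrank_vectorSpan_triple h]

lemma IsPlane.eq_affineSpan {P : Set Pt3} (hP : IsPlane P) {p q r : Pt3} (hp : p ∈ P)
    (hq : q ∈ P) (hr : r ∈ P) (h : ¬ Collinear ℝ {p, q, r}) :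
    P = (affineSpan ℝ ({p, q, r} : Set Pt3) : Set Pt3) := by
  obtain ⟨a, b, c, hi, rfl⟩ := hP
  refine congrArg _ (affineSpan_eq_of_mem ?_ hp hq hr h).symm
  rw [direction_affineSpan,
    finrank_vectorSpan_triple (affineIndependent_iff_not_collinear_set.1 hi)]

lemma isPlane_affineSpan {p q r : Pt3} (h : ¬ Collinear ℝ {p, q, r}) :
    IsPlane (affineSpan ℝ ({p, q, r} : Set Pt3) : Set Pt3) :=
  ⟨p, q, r, affineIndependent_iff_not_collinear_set.2 h, rfl⟩

lemma NoThreeCollinear.finite_detPlanes {S : Set Pt3} (hS : S.Finite) (h3 : NoThreeCollinear S) :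
    (detPlanes S).Finite := by
  refine ((hS.prod (hS.prod hS)).image fun x : Pt3 × Pt3 × Pt3 =>
    (affineSpan ℝ ({x.1, x.2.1, x.2.2} : Set Pt3) : Set Pt3)).subset ?_
  rintro P ⟨hP, hcard⟩
  obtain ⟨p, q, r, hp, hq, hr, hpq, hpr, hqr⟩ :=
    (Set.two_lt_ncard_iff (hS.subset Set.inter_subset_left)).1 hcard
  exact ⟨(p, q, r), ⟨hp.1, hq.1, hr.1⟩, (hP.eq_affineSpan hp.2 hq.2 hr.2
    (h3.not_collinear hp.1 hq.1 hr.1 hpq hpr hqr)).symm⟩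

open LineArrangement in
/-- Melchior's inequality for the projection of `S` from one of its points. -/
lemma NoThreeCollinear.sum_planes_through_le {S : Set Pt3} (hS : S.Finite)
    (h3 : NoThreeCollinear S) (hpl : ¬ Coplanar ℝ S) {p : Pt3} (hp : p ∈ S)
    {D : Finset (Set Pt3)} (hD : ∀ P, P ∈ D ↔ P ∈ detPlanes S ∧ p ∈ P) :
    ∑ P ∈ D, (((S ∩ P).ncard : ℤ) - 4) ≤ -3 := by
  classical
  obtain ⟨t, ht1, ht2⟩ := h3.exists_generic hS hp
  let ι := {q // q ∈ S ∧ q ≠ p}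
  have : Finite ι := (hS.subset (Set.sep_subset S (· ≠ p))).to_subtype
  have := Fintype.ofFinite ι
  let a : ι → ℝ := fun q => momentDeriv t (q.1 - p) / momentForm t (q.1 - p)
  let b : ι → ℝ := fun q => (q.1 - p) 2 / momentForm t (q.1 - p)
  have ha : Function.Injective a := by
    intro q r h
    by_contra hqr
    have hq := ht1 q.1 q.2.1 q.2.2
    have hr := ht1 r.1 r.2.1 r.2.2
    exact ht2 q.1 q.2.1 r.1 r.2.1 q.2.2 r.2.2 (fun e => hqr (Subtype.ext e))
      ((div_eq_div_iff hq hr).1 h)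
  have hthru : ∀ v (q : ι), Thru a b v q ↔ q.1 ∈ dualPlane t p v := by
    intro v q
    have hq := ht1 q.1 q.2.1 q.2.2
    rw [mem_dualPlane, dualForm_apply, sub_eq_zero, Thru, div_mul_eq_mul_div, ← add_div,
      div_eq_iff hq]
  have hpd : ∀ v, p ∈ dualPlane t p v := fun v => by simp [mem_dualPlane]
  have hne : ¬ ∃ v, ∀ i, Thru a b v i := by
    rintro ⟨v, hv⟩
    refine hpl ?_
    have hle : vectorSpan ℝ S ≤ LinearMap.ker (dualForm t v) := by
      rw [vectorSpan_eq_span_vsub_set_right ℝ hp, Submodule.span_le]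
      rintro _ ⟨q, hq, rfl⟩
      by_cases hqp : q = p
      · simp [hqp]
      · simpa [mem_dualPlane] using (hthru v ⟨q, hq, hqp⟩).1 (hv _)
    rw [coplanar_iff_finrank_le_two, ← finrank_ker_dualForm t v]
    exact Submodule.finrank_mono hle
  have hVfin : {v | ∃ i j, i ≠ j ∧ Thru a b v i ∧ Thru a b v j}.Finite := finite_setOf_vertices ha
  have hV : ∀ v, v ∈ hVfin.toFinset ↔ ∃ i j, i ≠ j ∧ Thru a b v i ∧ Thru a b v j := by simp
  have hcol : ∀ q r : ι, q ≠ r → ¬ Collinear ℝ {p, q.1, r.1} := fun q r hqr =>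
    h3.not_collinear hp q.2.1 r.2.1 q.2.2.symm r.2.2.symm fun e => hqr (Subtype.ext e)
  have hspan : ∀ v (q r : ι), q ≠ r → Thru a b v q → Thru a b v r →
      affineSpan ℝ {p, q.1, r.1} = dualPlane t p v := fun v q r hqr hq hr =>
    affineSpan_eq_of_mem (by rw [dualPlane, AffineSubspace.direction_mk', finrank_ker_dualForm])
      (hpd v) ((hthru v q).1 hq) ((hthru v r).1 hr) (hcol q r hqr)
  have hcard : ∀ v, (S ∩ dualPlane t p v).ncard =
      ({i | Thru a b v i} : Finset ι).card + 1 := by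
    intro v
    have : S ∩ dualPlane t p v =
        insert p (Subtype.val '' (({i | Thru a b v i} : Finset ι) : Set ι)) := by
      ext z
      by_cases hz : z = p
      · simp [hz, hp, hpd v]
      · simp [hz, hthru]
        tauto
    rw [this, Set.ncard_insert_of_notMem (by simp) (Set.toFinite _),
      Set.ncard_image_of_injective _ Subtype.val_injective, Set.ncard_coe_finset]
  refine le_of_eq_of_le (Eq.symm ?_) (melchior hV ha hne)
  refine Finset.sum_bij (fun v _ => (dualPlane t p v : Set Pt3)) ?_ ?_ ?_ ?_
  · intro v hv
    obtain ⟨q, r, hqr, hq, hr⟩ := (hV v).1 hv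
    refine (hD _).2 ⟨⟨?_, ?_⟩, hpd v⟩
    · rw [← hspan v q r hqr hq hr]
      exact isPlane_affineSpan (hcol q r hqr)
    · have := Finset.one_lt_card (s := {i | Thru a b v i}) |>.2
        ⟨q, by simpa using hq, r, by simpa using hr, hqr⟩
      rw [hcard]
      omega
  · intro v hv w _ h
    obtain ⟨q, r, hqr, hq, hr⟩ := (hV v).1 hv
    rw [SetLike.coe_set_eq] at h
    exact Thru.eq_of_ne ha hqr hq hr ((hthru w q).2 (h ▸ (hthru v q).1 hq))
      ((hthru w r).2 (h ▸ (hthru v r).1 hr))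
  · intro P hP
    obtain ⟨⟨hPl, hPc⟩, hpP⟩ := (hD P).1 hP
    have hfin : (S ∩ P).Finite := hS.subset Set.inter_subset_left
    obtain ⟨q, r, hq, hr, hqr⟩ := (Set.one_lt_ncard_iff (hfin.subset Set.sdiff_subset)).1
      (show 1 < ((S ∩ P) \ {p}).ncard by
        rw [Set.ncard_sdiff_singleton_of_mem (show p ∈ S ∩ P from ⟨hp, hpP⟩)]; omega)
    let q' : ι := ⟨q, hq.1.1, hq.2⟩
    let r' : ι := ⟨r, hr.1.1, hr.2⟩
    have hqr' : q' ≠ r' := fun e => hqr (congrArg Subtype.val e)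
    obtain ⟨x, e⟩ := exists_crossing (b := b q') (d := b r') (ha.ne hqr')
    have hv1 : Thru a b (x, a q' * x + b q') q' := rfl
    have hv2 : Thru a b (x, a q' * x + b q') r' := e.symm
    refine ⟨_, (hV _).2 ⟨q', r', hqr', hv1, hv2⟩, ?_⟩
    rw [← hspan _ q' r' hqr' hv1 hv2]
    exact (hPl.eq_affineSpan hpP hq.1.2 hr.1.2 (hcol q' r' hqr')).symm
  · intro v _
    rw [hcard]
    push_cast
    ring

end Projection

theorem stmt6 (S : Set Pt3) (hS : S.Finite) (n : ℕ) (hn : S.ncard = n)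
    (h3 : NoThreeCollinear S) (hpl : ¬ Coplanar ℝ S) :
    -3 * (n : ℤ) ≥ ∑ k ∈ Finset.Icc 3 n, (k : ℤ) * ((k : ℤ) - 4) * planeCount S k := by
  classical
  have hDfin := h3.finite_detPlanes hS
  let D := hDfin.toFinset
  have hD : ∀ P, P ∈ D ↔ P ∈ detPlanes S := by simp [D]
  have hcount : ∀ k ∈ Finset.Icc 3 n, planeCount S k = {P ∈ D | (S ∩ P).ncard = k}.card := by
    intro k hk
    rw [planeCount, ← Set.ncard_coe_finset]
    congr 1
    ext P
    have h3k := (Finset.mem_Icc.1 hk).1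
    simp only [Set.mem_ofPred_eq, Finset.coe_filter, hD, detPlanes]
    constructor
    · rintro ⟨hP, rfl⟩
      exact ⟨⟨hP, h3k⟩, rfl⟩
    · rintro ⟨⟨hP, -⟩, h⟩
      exact ⟨hP, h⟩
  have hmaps : ∀ P ∈ D, (S ∩ P).ncard ∈ Finset.Icc 3 n := fun P hP =>
    Finset.mem_Icc.2 ⟨((hD P).1 hP).2, hn ▸ Set.ncard_le_ncard Set.inter_subset_left hS⟩
  have hS' : hS.toFinset.card = n := by rw [← hn, Set.ncard_eq_toFinset_card S hS]
  calc ∑ k ∈ Finset.Icc 3 n, (k : ℤ) * ((k : ℤ) - 4) * planeCount S k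
      = ∑ k ∈ Finset.Icc 3 n, ∑ P ∈ D with (S ∩ P).ncard = k,
          ((S ∩ P).ncard : ℤ) * ((S ∩ P).ncard - 4) := by
        refine Finset.sum_congr rfl fun k hk => ?_
        rw [hcount k hk, Finset.sum_congr rfl (g := fun _ => (k : ℤ) * (k - 4))
          fun P hP => by rw [(Finset.mem_filter.1 hP).2], Finset.sum_const, nsmul_eq_mul, mul_comm]
    _ = ∑ P ∈ D, ((S ∩ P).ncard : ℤ) * ((S ∩ P).ncard - 4) :=
        Finset.sum_fiberwise_of_maps_to hmaps _
    _ = ∑ P ∈ D, ∑ p ∈ hS.toFinset with p ∈ P, (((S ∩ P).ncard : ℤ) - 4) := by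
        refine Finset.sum_congr rfl fun P _ => ?_
        rw [Finset.sum_const, nsmul_eq_mul, ← Set.ncard_coe_finset]
        congr 3
        ext p
        simp
    _ = ∑ p ∈ hS.toFinset, ∑ P ∈ D with p ∈ P, (((S ∩ P).ncard : ℤ) - 4) :=
        Finset.sum_comm' fun P p => by simp only [Finset.mem_filter]; tauto
    _ ≤ ∑ p ∈ hS.toFinset, (-3 : ℤ) := Finset.sum_le_sum fun p hp =>
        h3.sum_planes_through_le hS hpl (hS.mem_toFinset.1 hp) fun P => by
          rw [Finset.mem_filter, hD]
    _ = -3 * (n : ℤ) := by rw [Finset.sum_const, hS', nsmul_eq_mul, mul_comm]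
end
end

section
/- Let S be a set of n points in ℝ³, not all coplanar and no three collinear, and suppose some plane contains exactly n − k points of S. Then the total number m of planes determined by S satisfies m ≥ 1 + k·C(n−k,2) − C(k,2)·(n−k)/2 (as an inequality of real numbers). -/
open Set

noncomputable section

/-- A natural number is at most one more than the number of its pairs. -/
theorem Nat.le_one_add_choose_two (j : ℕ) : j ≤ 1 + j.choose 2 := by
  induction j with
  | zero => simp
  | succ j ih =>
    rw [Nat.choose_succ_succ' j 1, Nat.choose_one_right]
    rcases j with _ | j
    · simp
    · omega

section Blocks

variable {α : Type*} [DecidableEq α] {S A : Finset α} {F : Finset (Finset α)}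

/-- A block system on `S` in which any three points lie in a unique block: the number of pairs
formed by a point off the block `A` and a pair in `A` is bounded by the incidences with blocks
meeting `A` in two points. -/
theorem card_sdiff_mul_choose_le_sum
    (hex : ∀ T ⊆ S, T.card = 3 → ∃ B ∈ F, T ⊆ B) (hsub : ∀ B ∈ F, B ⊆ S)
    (huniq : ∀ B ∈ F, ∀ C ∈ F, 3 ≤ (B ∩ C).card → B = C) (hA : A ∈ F) :
    (S \ A).card * A.card.choose 2 ≤
      ∑ B ∈ F with (B ∩ A).card = 2, (B \ A).card := by
  calc (S \ A).card * A.card.choose 2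
      = ((S \ A) ×ˢ A.powersetCard 2).card := by
        rw [Finset.card_product, Finset.card_powersetCard]
    _ ≤ (Finset.biUnion {B ∈ F | (B ∩ A).card = 2}
          fun B => (B \ A) ×ˢ (B ∩ A).powersetCard 2).card := by
        apply Finset.card_le_card
        rintro ⟨p, e⟩ hpe
        simp only [Finset.mem_product, Finset.mem_sdiff, Finset.mem_powersetCard] at hpe
        obtain ⟨⟨hpS, hpA⟩, heA, he⟩ := hpe
        obtain ⟨B, hB, hTB⟩ := hex (insert p e)
          (Finset.insert_subset hpS (heA.trans (hsub A hA)))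
          (by rw [Finset.card_insert_of_notMem fun h => hpA (heA h), he])
        have hpB : p ∈ B := hTB (Finset.mem_insert_self _ _)
        have heB : e ⊆ B ∩ A :=
          Finset.subset_inter ((Finset.subset_insert _ _).trans hTB) heA
        have hle := Finset.card_le_card heB
        have hlt : (B ∩ A).card < 3 := by
          by_contra! h
          exact hpA (huniq B hB A hA h ▸ hpB)
        simp only [Finset.mem_biUnion, Finset.mem_filter, Finset.mem_product, Finset.mem_sdiff,
          Finset.mem_powersetCard]
        exact ⟨B, ⟨hB, by omega⟩, ⟨hpB, hpA⟩, heB, he⟩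
    _ ≤ ∑ B ∈ F with (B ∩ A).card = 2, ((B \ A) ×ˢ (B ∩ A).powersetCard 2).card :=
        Finset.card_biUnion_le
    _ = ∑ B ∈ F with (B ∩ A).card = 2, (B \ A).card := by
        refine Finset.sum_congr rfl fun B hB => ?_
        rw [Finset.card_product, Finset.card_powersetCard, (Finset.mem_filter.1 hB).2]
        simp

/-- Counting pairs off `A` together with a point of `A`, over the blocks meeting `A` in two
points. -/
theorem sum_choose_mul_two_le (hsub : ∀ B ∈ F, B ⊆ S)
    (huniq : ∀ B ∈ F, ∀ C ∈ F, 3 ≤ (B ∩ C).card → B = C) :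
    (∑ B ∈ F with (B ∩ A).card = 2, (B \ A).card.choose 2) * 2 ≤
      (S \ A).card.choose 2 * A.card := by
  calc (∑ B ∈ F with (B ∩ A).card = 2, (B \ A).card.choose 2) * 2
      = ∑ B ∈ F with (B ∩ A).card = 2, ((B \ A).powersetCard 2 ×ˢ (B ∩ A)).card := by
        rw [Finset.sum_mul]
        refine Finset.sum_congr rfl fun B hB => ?_
        rw [Finset.card_product, Finset.card_powersetCard, (Finset.mem_filter.1 hB).2]
    _ = (Finset.biUnion {B ∈ F | (B ∩ A).card = 2}
          fun B => (B \ A).powersetCard 2 ×ˢ (B ∩ A)).card := by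
        rw [Finset.card_biUnion]
        intro B hB C hC hBC
        rw [Function.onFun, Finset.disjoint_left]
        rintro ⟨e, a⟩ h₁ h₂
        simp only [Finset.mem_product, Finset.mem_powersetCard, Finset.mem_inter] at h₁ h₂
        obtain ⟨⟨heB, he⟩, haB, haA⟩ := h₁
        obtain ⟨⟨heC, -⟩, haC, -⟩ := h₂
        refine hBC (huniq B (Finset.mem_filter.1 hB).1 C (Finset.mem_filter.1 hC).1 ?_)
        have hae : a ∉ e := fun h => (Finset.mem_sdiff.1 (heB h)).2 haA
        calc 3 = (insert a e).card := by rw [Finset.card_insert_of_notMem hae, he]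
          _ ≤ (B ∩ C).card := Finset.card_le_card <|
            Finset.insert_subset (Finset.mem_inter.2 ⟨haB, haC⟩) <| Finset.subset_inter
              (heB.trans Finset.sdiff_subset) (heC.trans Finset.sdiff_subset)
    _ ≤ ((S \ A).powersetCard 2 ×ˢ A).card := by
        apply Finset.card_le_card
        refine Finset.biUnion_subset.2 fun B hB => Finset.product_subset_product
          (Finset.powersetCard_mono ?_) Finset.inter_subset_right
        exact Finset.sdiff_subset_sdiff (hsub B (Finset.mem_filter.1 hB).1) le_rfl
    _ = (S \ A).card.choose 2 * A.card := by
        rw [Finset.card_product, Finset.card_powersetCard]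

/-- Lower bound for the number of blocks in terms of the size of a given block. -/
theorem two_mul_card_blocks_ge
    (hex : ∀ T ⊆ S, T.card = 3 → ∃ B ∈ F, T ⊆ B) (hsub : ∀ B ∈ F, B ⊆ S)
    (huniq : ∀ B ∈ F, ∀ C ∈ F, 3 ≤ (B ∩ C).card → B = C) (hA : A ∈ F) (hA3 : 3 ≤ A.card) :
    2 + 2 * ((S \ A).card * A.card.choose 2) ≤
      2 * F.card + (S \ A).card.choose 2 * A.card := by
  have h₁ := card_sdiff_mul_choose_le_sum hex hsub huniq hA
  have h₂ := sum_choose_mul_two_le (A := A) hsub huniq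
  have h₃ : ∑ B ∈ F with (B ∩ A).card = 2, (B \ A).card ≤
      ({B ∈ F | (B ∩ A).card = 2}).card +
        ∑ B ∈ F with (B ∩ A).card = 2, (B \ A).card.choose 2 := by
    rw [Finset.card_eq_sum_ones, ← Finset.sum_add_distrib]
    exact Finset.sum_le_sum fun B _ => Nat.le_one_add_choose_two _
  have h₄ : ({B ∈ F | (B ∩ A).card = 2}).card < F.card := by
    refine Finset.card_lt_card (Finset.filter_ssubset.2 ⟨A, hA, ?_⟩)
    rw [Finset.inter_self]
    omega
  omega

/-- If no block contains all of `S`, there are at least two blocks. -/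
theorem two_le_card_blocks (hex : ∀ T ⊆ S, T.card = 3 → ∃ B ∈ F, T ⊆ B)
    (hS : ∀ B ∈ F, ¬ S ⊆ B) (h3 : 3 ≤ S.card) : 2 ≤ F.card := by
  obtain ⟨T, hT, hT3⟩ := Finset.exists_subset_card_eq h3
  obtain ⟨B, hB, hTB⟩ := hex T hT hT3
  obtain ⟨d, hdS, hdB⟩ := Finset.not_subset.1 (hS B hB)
  obtain ⟨e, he, he2⟩ := Finset.exists_subset_card_eq (show 2 ≤ T.card by omega)
  obtain ⟨C, hC, hTC⟩ := hex (insert d e) (Finset.insert_subset hdS (he.trans hT))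
    (by rw [Finset.card_insert_of_notMem fun h => hdB (hTB (he h)), he2])
  refine Finset.one_lt_card.2 ⟨B, hB, C, hC, ?_⟩
  rintro rfl
  exact hdB (hTC (Finset.mem_insert_self _ _))

end Blocks

/-- A plane is the affine span of any three non-collinear points on it. -/
theorem IsPlane.eq_affineSpan_s10 {P T : Set Pt3} (hP : IsPlane P) (hT : T.ncard = 3)
    (hcol : ¬ Collinear ℝ T) (hTP : T ⊆ P) : P = affineSpan ℝ T := by
  obtain ⟨a, b, c, habc, rfl⟩ := hP
  obtain ⟨x, y, z, -, -, -, rfl⟩ := Set.ncard_eq_three.1 hT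
  have hxyz := affineIndependent_iff_not_collinear_set.2 hcol
  have hrange : ∀ u v w : Pt3, Set.range ![u, v, w] = {u, v, w} := fun u v w => by
    simp only [Matrix.range_cons, Matrix.range_empty, Set.union_empty, Set.singleton_union]
  have hdir : Module.finrank ℝ (affineSpan ℝ ({a, b, c} : Set Pt3)).direction = 2 := by
    rw [direction_affineSpan, ← hrange]
    exact habc.finrank_vectorSpan (by simp)
  have h := hxyz.affineSpan_eq_of_le_of_card_eq_finrank_add_one
    (sp := affineSpan ℝ ({a, b, c} : Set Pt3))
    (by rw [hrange]; exact affineSpan_le.2 hTP) (by rw [hdir]; simp)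
  rw [← h, hrange]

/-- Three non-collinear points span a plane. -/
theorem isPlane_affineSpan_s10 {T : Set Pt3} (hT : T.ncard = 3) (hcol : ¬ Collinear ℝ T) :
    IsPlane (affineSpan ℝ T) := by
  obtain ⟨x, y, z, -, -, -, rfl⟩ := Set.ncard_eq_three.1 hT
  exact ⟨x, y, z, affineIndependent_iff_not_collinear_set.2 hcol, rfl⟩

theorem IsPlane.coplanar {P : Set Pt3} (hP : IsPlane P) : Coplanar ℝ P := by
  obtain ⟨a, b, c, -, rfl⟩ := hP
  rw [coplanar_iff_finrank_le_two, ← direction_affineSpan, AffineSubspace.affineSpan_coe,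
    direction_affineSpan, ← coplanar_iff_finrank_le_two]
  exact coplanar_triple ℝ a b c

/-- Two planes meeting in three points of a set without collinear triples coincide. -/
theorem NoThreeCollinear.plane_eq {S P Q : Set Pt3} (h3 : NoThreeCollinear S)
    (hP : IsPlane P) (hQ : IsPlane Q) (h : 3 ≤ (S ∩ P ∩ Q).ncard) : P = Q := by
  obtain ⟨T, hT, hT3⟩ := Set.exists_subset_card_eq h
  have hcol := h3 T (fun x hx => (hT hx).1.1) hT3
  rw [hP.eq_affineSpan_s10 hT3 hcol fun x hx => (hT hx).1.2,
    hQ.eq_affineSpan_s10 hT3 hcol fun x hx => (hT hx).2]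

theorem three_le_ncard_of_not_coplanar {S : Set Pt3} (hS : S.Finite) (h : ¬ Coplanar ℝ S) :
    3 ≤ S.ncard := by
  by_contra! hlt
  refine h (Collinear.coplanar ?_)
  obtain h0 | h1 | h2 : S.ncard = 0 ∨ S.ncard = 1 ∨ S.ncard = 2 := by omega
  · rw [(Set.ncard_eq_zero hS).1 h0]
    exact collinear_empty ℝ _
  · obtain ⟨a, rfl⟩ := Set.ncard_eq_one.1 h1
    exact collinear_singleton ℝ a
  · obtain ⟨a, b, -, rfl⟩ := Set.ncard_eq_two.1 h2
    exact collinear_pair ℝ a b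

theorem stmt10 (S : Set Pt3) (hS : S.Finite) (n k : ℕ) (hn : S.ncard = n)
    (h3 : NoThreeCollinear S) (hpl : ¬ Coplanar ℝ S)
    (P : Set Pt3) (hP : IsPlane P) (hcap : ((S ∩ P).ncard : ℤ) = (n : ℤ) - k) :
    ((detPlanes S).ncard : ℝ) ≥
      1 + (k : ℝ) * ((n - k).choose 2 : ℝ) - (k.choose 2 : ℝ) * ((n : ℝ) - k) / 2 := by
  classical
  lift S to Finset Pt3 using hS
  rw [Set.ncard_coe_finset] at hn
  let tr : Set Pt3 → Finset Pt3 := fun Q => {x ∈ S | x ∈ Q}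
  have htr (Q : Set Pt3) : (tr Q : Set Pt3) = ↑S ∩ Q := by ext; simp [tr]
  have hcard (Q : Set Pt3) : ((S : Set Pt3) ∩ Q).ncard = (tr Q).card := by
    rw [← htr, Set.ncard_coe_finset]
  have hinter (Q R : Set Pt3) : ((S : Set Pt3) ∩ Q ∩ R).ncard = (tr Q ∩ tr R).card := by
    rw [← Set.ncard_coe_finset, Finset.coe_inter, htr, htr]
    congr 1
    ext
    simp only [Set.mem_inter_iff]
    tauto
  let F : Finset (Finset Pt3) := {B ∈ S.powerset | B ∈ tr '' detPlanes S}
  have hF (B : Finset Pt3) : B ∈ F ↔ ∃ Q, (IsPlane Q ∧ 3 ≤ (tr Q).card) ∧ tr Q = B := by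
    simp only [F, Finset.mem_filter, Finset.mem_powerset, Set.mem_image, detPlanes,
      Set.mem_ofPred_eq, hcard]
    refine ⟨And.right, fun h => ⟨?_, h⟩⟩
    obtain ⟨Q, -, rfl⟩ := h
    exact Finset.filter_subset _ _
  have hFcard : (detPlanes S).ncard = F.card := by
    rw [← Set.ncard_coe_finset, ← Set.InjOn.ncard_image (f := tr) (s := detPlanes S)]
    · congr 1
      ext B
      simp only [Finset.mem_coe, hF, Set.mem_image, detPlanes, Set.mem_ofPred_eq, hcard]
    · rintro Q ⟨hQ, hQ3⟩ R ⟨hR, -⟩ hQR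
      refine h3.plane_eq hQ hR ?_
      rw [hinter, ← hQR, Finset.inter_self, ← hcard]
      exact hQ3
  have hsub : ∀ B ∈ F, B ⊆ S := fun B hB => by
    obtain ⟨Q, -, rfl⟩ := (hF B).1 hB
    exact Finset.filter_subset _ _
  have huniq : ∀ B ∈ F, ∀ C ∈ F, 3 ≤ (B ∩ C).card → B = C := by
    intro B hB C hC h
    obtain ⟨Q, ⟨hQ, -⟩, rfl⟩ := (hF B).1 hB
    obtain ⟨R, ⟨hR, -⟩, rfl⟩ := (hF C).1 hC
    rw [h3.plane_eq hQ hR (by rwa [hinter])]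
  have hex : ∀ T ⊆ S, T.card = 3 → ∃ B ∈ F, T ⊆ B := by
    intro T hT hT3
    have hT3' : (T : Set Pt3).ncard = 3 := by rwa [Set.ncard_coe_finset]
    have hsubset : T ⊆ tr (affineSpan ℝ (T : Set Pt3)) := fun x hx =>
      Finset.mem_filter.2 ⟨hT hx, subset_affineSpan ℝ _ hx⟩
    exact ⟨_, (hF _).2 ⟨_, ⟨isPlane_affineSpan_s10 hT3' (h3 T (Finset.coe_subset.2 hT) hT3'),
      hT3.symm.le.trans (Finset.card_le_card hsubset)⟩, rfl⟩, hsubset⟩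
  have hproper : ∀ B ∈ F, ¬ S ⊆ B := by
    intro B hB hSB
    obtain ⟨Q, ⟨hQ, -⟩, rfl⟩ := (hF B).1 hB
    exact hpl (hQ.coplanar.subset fun x hx => (Finset.mem_filter.1 (hSB hx)).2)
  have htwo : 2 ≤ F.card := two_le_card_blocks hex hproper <| by
    simpa using three_le_ncard_of_not_coplanar S.finite_toSet hpl
  rw [hcard] at hcap
  have hkn : k ≤ n := by omega
  have hr : (tr P).card = n - k := by omega
  have hk : (S \ tr P).card = k := by
    have := Finset.card_sdiff_add_card_eq_card (Finset.filter_subset (· ∈ P) S)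
    change (S \ tr P).card + (tr P).card = _ at this
    omega
  have key : 2 + 2 * (k * (n - k).choose 2) ≤ 2 * F.card + k.choose 2 * (n - k) := by
    by_cases hlt : 3 ≤ n - k
    · have := two_mul_card_blocks_ge hex hsub huniq ((hF _).2 ⟨P, ⟨hP, by omega⟩, rfl⟩)
        (by omega)
      rwa [hk, hr] at this
    · have := Nat.le_one_add_choose_two k
      obtain h | h | h : n - k = 0 ∨ n - k = 1 ∨ n - k = 2 := by omega
      all_goals
        rw [h]
        simp only [Nat.choose_zero_succ, Nat.choose_self,
          Nat.choose_eq_zero_of_lt (show 1 < 2 by decide)]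
        omega
  have key' : (2 : ℝ) + 2 * (k * (n - k).choose 2) ≤
      2 * F.card + k.choose 2 * ((n : ℝ) - k) := by
    rw [← Nat.cast_sub hkn]
    exact_mod_cast key
  rw [hFcard, ge_iff_le]
  linarith
end
end
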